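/- If φ contains no occurrence of ∃x or i ≈ x (i.e., φ is a pure temporal-epistemic formula), then the satisfaction relation Γ, I(E,Σ), (r,m) ⊨ φ is independent of the context Γ: for all contexts Γ, Γ', Γ, I(E,Σ), (r,m) ⊨ φ iff Γ', I(E,Σ), (r,m) ⊨ φ. Hence ESL conservatively extends the temporal epistemic logic CTL*K(Ags ∪ σ(Ags), Prop). -/

import Mathlib

/-- Syntax of extended temporal epistemic logic ETL(Ag, Pp, Var). -/
inductive Fml (Ag Pp Var : Type) : Type where
  | atom : Pp → Fml Ag Pp Var
  | neg  : Fml Ag Pp Var → Fml Ag Pp Var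
  | or   : Fml Ag Pp Var → Fml Ag Pp Var → Fml Ag Pp Var
  | all  : Fml Ag Pp Var → Fml Ag Pp Var
  | next : Fml Ag Pp Var → Fml Ag Pp Var
  | until_ : Fml Ag Pp Var → Fml Ag Pp Var → Fml Ag Pp Var
  | exG  : Var → Fml Ag Pp Var → Fml Ag Pp Var
  | lid  : Ag → Var → Fml Ag Pp Var
  | dk   : Set Ag → Fml Ag Pp Var → Fml Ag Pp Var
  | ck   : Set Ag → Fml Ag Pp Var → Fml Ag Pp Var

namespace Fml
variable {Ag Pp Var : Type}

def and (φ ψ : Fml Ag Pp Var) : Fml Ag Pp Var := .neg (.or (.neg φ) (.neg ψ))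
def impl (φ ψ : Fml Ag Pp Var) : Fml Ag Pp Var := .or (.neg φ) ψ

/-- Free variables of a formula. -/
def FV : Fml Ag Pp Var → Set Var
  | atom _ => ∅
  | neg φ => FV φ
  | or φ ψ => FV φ ∪ FV ψ
  | all φ => FV φ
  | next φ => FV φ
  | until_ φ ψ => FV φ ∪ FV ψ
  | exG x φ => FV φ \ {x}
  | lid _ x => {x}
  | dk _ φ => FV φ
  | ck _ φ => FV φ

end Fml

section Semantics

variable {Ag Pp Var GS : Type} {L : Ag → Type} [DecidableEq Var]

/-- Satisfaction relation `Γ, I, (r,m) ⊨ φ` for an interpreted system whose runs are the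
set `R` of maps `ℕ → GS`, with local-state projections `loc` and valuation `val`. -/
def Sat (loc : ∀ a : Ag, GS → L a) (R : Set (ℕ → GS)) (val : (ℕ → GS) → ℕ → Set Pp) :
    (Var → GS) → {r : ℕ → GS // r ∈ R} → ℕ → Fml Ag Pp Var → Prop
  | _, r, m, .atom p => p ∈ val r.1 m
  | Γ, r, m, .neg φ => ¬ Sat loc R val Γ r m φ
  | Γ, r, m, .or φ ψ => Sat loc R val Γ r m φ ∨ Sat loc R val Γ r m ψ
  | Γ, r, m, .all φ =>
      ∀ r' : {r : ℕ → GS // r ∈ R}, (∀ k, k ≤ m → r'.1 k = r.1 k) → Sat loc R val Γ r' m φ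
  | Γ, r, m, .next φ => Sat loc R val Γ r (m + 1) φ
  | Γ, r, m, .until_ φ ψ =>
      ∃ m', m ≤ m' ∧ Sat loc R val Γ r m' ψ ∧ ∀ k, m ≤ k → k < m' → Sat loc R val Γ r k φ
  | Γ, r, m, .exG x φ =>
      ∃ (r' : {r : ℕ → GS // r ∈ R}) (m' : ℕ),
        Sat loc R val (Function.update Γ x (r'.1 m')) r m φ
  | Γ, r, m, .lid i x => loc i (r.1 m) = loc i (Γ x)
  | Γ, r, m, .dk G φ =>
      ∀ (r' : {r : ℕ → GS // r ∈ R}) (m' : ℕ),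
        (∀ i ∈ G, loc i (r'.1 m') = loc i (r.1 m)) → Sat loc R val Γ r' m' φ
  | Γ, r, m, .ck G φ =>
      ∀ p' : {r : ℕ → GS // r ∈ R} × ℕ,
        Relation.ReflTransGen
          (fun a b => ∃ i ∈ G, loc i (a.1.1 a.2) = loc i (b.1.1 b.2)) (r, m) p' →
        Sat loc R val Γ p'.1 p'.2 φ

end Semantics

/-- An environment for agents `Ag`, with states `S`, actions `Act i`, local states `L i`. -/
structure Env (Ag S : Type) (Act L : Ag → Type) (Pp : Type) where
  init : Set S
  trans : S → (∀ i, Act i) → S → Prop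
  obs : ∀ i : Ag, S → L i
  val : S → Set Pp

/-- A strategy: a nonempty set of enabled actions at each state. -/
def Strat (S A : Type) : Type := {f : S → Set A // ∀ s, (f s).Nonempty}

/-- Global states of the strategy space system `I(E,Σ)`. -/
structure GSS (Ag S : Type) (Act L : Ag → Type) : Type where
  env : S
  loc : ∀ i : Ag, L i
  str : ∀ i : Ag, Strat S (Act i)

variable {Ag S : Type} {Act L : Ag → Type} {Pp : Type}

/-- The four run constraints of the strategy space system `I(E,Σ)`. -/
def IsRun (E : Env Ag S Act L Pp) (Sig : Set (∀ i, Strat S (Act i)))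
    (r : ℕ → GSS Ag S Act L) : Prop :=
  ((r 0).env ∈ E.init ∧ (fun i => (r 0).str i) ∈ Sig) ∧
  (∀ m i, (r m).loc i = E.obs i (r m).env) ∧
  (∀ m, ∃ a : ∀ i, Act i,
      E.trans (r m).env a (r (m + 1)).env ∧ ∀ j, a j ∈ ((r m).str j).1 (r m).env) ∧
  (∀ m i, (r (m + 1)).str i = (r m).str i)

/-- Agents of the strategy space system: ordinary agents, strategic agents `σ(i)`,
and the environment agent `e`. -/
inductive AgE (Ag : Type) : Type where
  | ag : Ag → AgE Ag
  | sg : Ag → AgE Ag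
  | env : AgE Ag

/-- Local state types of the extended agents. -/
def LExt (Ag S : Type) (Act L : Ag → Type) : AgE Ag → Type
  | .ag i => L i
  | .sg i => Strat S (Act i)
  | .env => S

/-- Local state projections of the strategy space system: agent `i` sees its local
state, `σ(i)` sees agent `i`'s strategy, and `e` sees the state of the environment. -/
def locE {Ag S : Type} {Act L : Ag → Type} :
    ∀ a : AgE Ag, GSS Ag S Act L → LExt Ag S Act L a
  | .ag i, g => g.loc i
  | .sg i, g => g.str i
  | .env, g => g.env

/-- The valuation of `I(E,Σ)`, inherited from the environment. -/
def valE {Ag S : Type} {Act L : Ag → Type} {Pp : Type} (E : Env Ag S Act L Pp) :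
    (ℕ → GSS Ag S Act L) → ℕ → Set Pp :=
  fun r m => E.val (r m).env

/-- A pure temporal-epistemic formula: no occurrence of `∃x` or `i ≈ x`. -/
def PureFml {Ag Pp Var : Type} : Fml Ag Pp Var → Prop
  | .atom _ => True
  | .neg φ => PureFml φ
  | .or φ ψ => PureFml φ ∧ PureFml ψ
  | .all φ => PureFml φ
  | .next φ => PureFml φ
  | .until_ φ ψ => PureFml φ ∧ PureFml ψ
  | .exG _ _ => False
  | .lid _ _ => False
  | .dk _ φ => PureFml φ
  | .ck _ φ => PureFml φ

/-- If `φ` contains no occurrence of `∃x` or `i ≈ x`, then satisfaction in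
the strategy space system `I(E,Σ)` is independent of the context `Γ`; hence ESL
conservatively extends the temporal epistemic logic `CTL*K(Ags ∪ σ(Ags), Prop)`. -/
theorem pure_formula_context_independent {Var : Type} [DecidableEq Var]
    (E : Env Ag S Act L Pp) (Sig : Set (∀ i, Strat S (Act i)))
    (φ : Fml (AgE Ag) Pp Var) (hφ : PureFml φ)
    (Γ Γ' : Var → GSS Ag S Act L)
    (r : {r : ℕ → GSS Ag S Act L // r ∈ {r | IsRun E Sig r}}) (m : ℕ) :
    Sat locE {r | IsRun E Sig r} (valE E) Γ r m φ ↔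
    Sat locE {r | IsRun E Sig r} (valE E) Γ' r m φ := by
  induction φ generalizing r m with
  | atom p => simp only [Sat]
  | neg φ ih =>
    simp only [Sat]
    exact not_congr (ih hφ r m)
  | or φ ψ ih1 ih2 =>
    simp only [Sat]
    exact or_congr (ih1 hφ.1 r m) (ih2 hφ.2 r m)
  | all φ ih =>
    simp only [Sat]
    exact forall_congr' fun r' => imp_congr_right fun _ => ih hφ r' m
  | next φ ih =>
    simp only [Sat]
    exact ih hφ r (m + 1)
  | until_ φ ψ ih1 ih2 =>
    simp only [Sat]
    exact exists_congr fun m' => and_congr_right fun _ =>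
      and_congr (ih2 hφ.2 r m') (forall_congr' fun k =>
        imp_congr_right fun _ => imp_congr_right fun _ => ih1 hφ.1 r k)
  | exG x φ ih => exact hφ.elim
  | lid i x => exact hφ.elim
  | dk G φ ih =>
    simp only [Sat]
    exact forall_congr' fun r' => forall_congr' fun m' =>
      imp_congr_right fun _ => ih hφ r' m'
  | ck G φ ih =>
    simp only [Sat]
    exact forall_congr' fun p' => imp_congr_right fun _ => ih hφ p'.1 p'.2
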